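/- Let p be a prime number and Λ = ℤ_p⟦T⟧ the ring of formal power series in one variable over the p-adic integers. Every finitely generated reflexive Λ-module is a free Λ-module. (A module M is reflexive if the canonical evaluation map M → Hom_Λ(Hom_Λ(M, Λ), Λ) is bijective.) -/

import Mathlib

open Pointwise in
/-- If `x` is prime, the reduction modulo `x` of a dual module is torsion-free over `R ⧸ (x)`. -/
lemma Module.Dual.isTorsionFree_quotSMulTop {R : Type*} [CommRing R] [IsDomain R] {x : R}
    (hx : Prime x) (N : Type*) [AddCommGroup N] [Module R N] :
    Module.IsTorsionFree (R ⧸ Ideal.span {x}) (QuotSMulTop x (Module.Dual R N)) := by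
  have : (Ideal.span {x}).IsPrime := (Ideal.span_singleton_prime hx.ne_zero).2 hx
  refine .of_smul_eq_zero fun r m h ↦ ?_
  obtain ⟨r, rfl⟩ := Ideal.Quotient.mk_surjective r
  obtain ⟨f, rfl⟩ := Submodule.mkQ_surjective _ m
  rw [or_iff_not_imp_left, Ideal.Quotient.eq_zero_iff_mem, Ideal.mem_span_singleton]
  intro hr
  have h' : Submodule.Quotient.mk (p := x • (⊤ : Submodule R (Module.Dual R N))) (r • f) = 0 := h
  rw [Submodule.Quotient.mk_eq_zero, Submodule.mem_smul_pointwise_iff_exists] at h'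
  obtain ⟨g, -, hg⟩ := h'
  have hdvd (n : N) : x ∣ f n :=
    (hx.dvd_or_dvd ⟨g n, by simpa using (DFunLike.congr_fun hg n).symm⟩).resolve_left hr
  choose k hk using hdvd
  rw [Submodule.mkQ_apply, Submodule.Quotient.mk_eq_zero, Submodule.mem_smul_pointwise_iff_exists]
  refine ⟨{ toFun := k, map_add' := fun a b ↦ ?_, map_smul' := fun c a ↦ ?_ }, trivial, ?_⟩
  · apply mul_left_cancel₀ hx.ne_zero
    rw [← hk, map_add, hk, hk, mul_add]
  · apply mul_left_cancel₀ hx.ne_zero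
    rw [← hk, map_smul, hk, RingHom.id_apply, smul_eq_mul, smul_eq_mul, mul_left_comm]
  · ext n
    exact (hk n).symm

/-- If `x` is a prime element in the Jacobson radical of a domain `R` and `R ⧸ (x)` is a principal
ideal ring, then every finitely presented dual module over `R` is free. -/
lemma Module.Dual.free_of_isPrincipalIdealRing_quotient {R : Type*} [CommRing R] [IsDomain R]
    {x : R} (hx : Prime x) (hmem : x ∈ (⊥ : Ideal R).jacobson)
    [IsPrincipalIdealRing (R ⧸ Ideal.span {x})] (N : Type*) [AddCommGroup N] [Module R N]
    [Module.FinitePresentation R (Module.Dual R N)] :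
    Module.Free R (Module.Dual R N) := by
  have : (Ideal.span {x}).IsPrime := (Ideal.span_singleton_prime hx.ne_zero).2 hx
  have := isTorsionFree_quotSMulTop hx N
  have : Module.Finite (R ⧸ Ideal.span {x}) (QuotSMulTop x (Module.Dual R N)) :=
    .of_restrictScalars_finite R _ _
  refine (Module.free_quotSMulTop_iff_free R _ hmem fun f g h ↦ ?_).1
    Module.free_of_finite_type_torsion_free'
  ext n
  exact mul_left_cancel₀ hx.ne_zero (DFunLike.congr_fun h n)

/-- The quotient `R⟦X⟧ ⧸ (X)` is a principal ideal ring if `R` is. -/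
lemma PowerSeries.isPrincipalIdealRing_quotient_span_X (R : Type*) [CommRing R]
    [IsPrincipalIdealRing R] :
    IsPrincipalIdealRing (PowerSeries R ⧸ Ideal.span {(X : PowerSeries R)}) := by
  refine IsPrincipalIdealRing.of_surjective ((Ideal.Quotient.mk _).comp (C (R := R))) fun y ↦ ?_
  obtain ⟨f, rfl⟩ := Ideal.Quotient.mk_surjective y
  refine ⟨constantCoeff f, ?_⟩
  rw [RingHom.comp_apply, Ideal.Quotient.eq, Ideal.mem_span_singleton, X_dvd_iff]
  simp

/-- The variable `X` lies in the Jacobson radical of `R⟦X⟧`. -/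
lemma PowerSeries.X_mem_jacobson_bot (R : Type*) [CommRing R] :
    (X : PowerSeries R) ∈ (⊥ : Ideal (PowerSeries R)).jacobson := by
  rw [Ideal.mem_jacobson_bot]
  intro f
  simp [isUnit_iff_constantCoeff]

/-- Every finitely generated reflexive module over `Λ = ℤ_p⟦T⟧` is free. -/
theorem stmt_5 (p : ℕ) [Fact p.Prime]
    (M : Type*) [AddCommGroup M] [Module (PowerSeries ℤ_[p]) M]
    [Module.Finite (PowerSeries ℤ_[p]) M]
    (hrefl : Function.Bijective (Module.Dual.eval (PowerSeries ℤ_[p]) M)) :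
    Module.Free (PowerSeries ℤ_[p]) M := by
  have e := LinearEquiv.ofBijective _ hrefl
  have := Module.Finite.equiv e
  have := Module.finitePresentation_of_finite (PowerSeries ℤ_[p])
    (Module.Dual (PowerSeries ℤ_[p]) (Module.Dual (PowerSeries ℤ_[p]) M))
  have := PowerSeries.isPrincipalIdealRing_quotient_span_X ℤ_[p]
  have := Module.Dual.free_of_isPrincipalIdealRing_quotient PowerSeries.X_prime
    (PowerSeries.X_mem_jacobson_bot ℤ_[p]) (Module.Dual (PowerSeries ℤ_[p]) M)
  exact .of_equiv e.symm
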